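/- Every extreme point of the set S₁ := {(v,u) ∈ ℝⁿ × S₀ⁿ : e(v,u) ≤ 1/2} lies in K₁ := {(v, v⊗v − (1/n)Iₙ) : |v| = 1}. -/

import Mathlib

open Matrix

noncomputable def lambdaMax {n : ℕ} (w : Matrix (Fin n) (Fin n) ℝ) : ℝ :=
  if h : w.IsHermitian then ⨆ i, h.eigenvalues i else 0

noncomputable def eFun {n : ℕ} (v : EuclideanSpace ℝ (Fin n))
    (u : Matrix (Fin n) (Fin n) ℝ) : ℝ :=
  (n / 2 : ℝ) * lambdaMax (vecMulVec (fun i => v i) (fun i => v i) - u)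

theorem eFun_le_iff {n : ℕ} (hn : 2 ≤ n) (v : EuclideanSpace ℝ (Fin n))
    (u : Matrix (Fin n) (Fin n) ℝ) (hu : u.IsSymm) :
    eFun v u ≤ 1 / 2 ↔ ((1 / (n : ℝ)) • (1 : Matrix (Fin n) (Fin n) ℝ)
      - (vecMulVec (fun i => v i) (fun i => v i) - u)).PosSemidef := by
  have hn0 : (0 : ℝ) < n := by exact_mod_cast (by omega : 0 < n)
  haveI : Nonempty (Fin n) := ⟨⟨0, by omega⟩⟩
  set w := vecMulVec (fun i => v i) (fun i => v i) - u with hw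
  have hwH : w.IsHermitian := by
    ext i j
    simp [hw, vecMulVec_apply, hu.apply i j, mul_comm]
  have h1 : eFun v u ≤ 1 / 2 ↔ lambdaMax w ≤ 1 / n := by
    unfold eFun
    rw [← hw, le_div_iff₀ hn0]
    constructor <;> intro h <;> linarith
  rw [h1, lambdaMax, dif_pos hwH, posSemidef_iff_isHermitian_and_spectrum_nonneg,
    ← Algebra.algebraMap_eq_smul_one, ← spectrum.singleton_sub_eq,
    hwH.spectrum_real_eq_range_eigenvalues, ciSup_le_iff (Set.finite_range _).bddAbove]
  constructor
  · intro h
    refine ⟨?_, ?_⟩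
    · refine IsHermitian.sub ?_ hwH
      rw [Algebra.algebraMap_eq_smul_one]
      ext i j
      simp [one_apply, eq_comm]
    · rintro _ ⟨a, ha, b, ⟨i, rfl⟩, rfl⟩
      rw [Set.mem_singleton_iff] at ha
      have := h i
      simp only [Set.mem_setOf_eq]
      linarith
  · rintro ⟨-, h⟩ i
    have := h (Set.sub_mem_sub (Set.mem_singleton _) (Set.mem_range_self i))
    simp only [Set.mem_setOf_eq] at this
    linarith

theorem psd_pert {n : ℕ} (B : Matrix (Fin n) (Fin n) ℝ) (k : Fin n) (s : ℝ) (hs : -1 ≤ s) :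
    (Bᵀ * B + s • vecMulVec (B k) (B k)).PosSemidef := by
  refine .of_dotProduct_mulVec_nonneg ?_ fun z => ?_
  · ext i j
    simp [mul_apply, vecMulVec_apply, mul_comm]
  · have e1 : z ⬝ᵥ ((Bᵀ * B) *ᵥ z) = ∑ i, (B *ᵥ z) i ^ 2 := by
      rw [← mulVec_mulVec, dotProduct_mulVec, vecMul_transpose]
      simp [dotProduct, sq]
    have e2 : z ⬝ᵥ (vecMulVec (B k) (B k) *ᵥ z) = (B *ᵥ z) k ^ 2 := by
      rw [vecMulVec_mulVec]
      simp [mulVec, dotProduct_comm z, sq]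
    have e3 : (B *ᵥ z) k ^ 2 ≤ ∑ i, (B *ᵥ z) i ^ 2 :=
      Finset.single_le_sum (f := fun i => (B *ᵥ z) i ^ 2) (fun i _ => sq_nonneg _)
        (Finset.mem_univ k)
    rw [star_trivial, add_mulVec, dotProduct_add, smul_mulVec, dotProduct_smul, e1, e2,
      smul_eq_mul]
    nlinarith [sq_nonneg ((B *ᵥ z) k)]

/-- every extreme point of `S₁ = {(v,u) ∈ ℝⁿ × S₀ⁿ : e(v,u) ≤ 1/2}`
lies in `K₁ = {(v, v⊗v − (1/n)Iₙ) : |v| = 1}`. -/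
theorem extremePoints_sublevel_subset_eulerStates (n : ℕ) (hn : 2 ≤ n) :
    Set.extremePoints ℝ
      {p : EuclideanSpace ℝ (Fin n) × Matrix (Fin n) (Fin n) ℝ |
        p.2.IsSymm ∧ p.2.trace = 0 ∧ eFun p.1 p.2 ≤ 1 / 2} ⊆
    {p : EuclideanSpace ℝ (Fin n) × Matrix (Fin n) (Fin n) ℝ |
      ∃ v : EuclideanSpace ℝ (Fin n), ‖v‖ = 1 ∧
        p = (v, vecMulVec (fun i => v i) (fun i => v i)
              - (1 / (n : ℝ)) • (1 : Matrix (Fin n) (Fin n) ℝ))} := by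
  rintro ⟨v, u⟩ hp
  obtain ⟨⟨hu, htr, he⟩, hext⟩ := mem_extremePoints.1 hp
  simp only at hu htr he
  have hn0 : (0 : ℝ) < n := by exact_mod_cast (by omega : 0 < n)
  have hW := (eFun_le_iff hn v u hu).1 he
  obtain ⟨B, hB⟩ : ∃ B : Matrix (Fin n) (Fin n) ℝ, (1 / (n : ℝ)) • (1 : Matrix (Fin n) (Fin n) ℝ)
      - (vecMulVec (fun i => v i) (fun i => v i) - u) = Bᵀ * B := by
    open scoped MatrixOrder in
    obtain ⟨B, hB⟩ := CStarAlgebra.nonneg_iff_eq_star_mul_self.1 hW.nonneg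
    exact ⟨B, by rw [hB, star_eq_conjTranspose, conjTranspose_eq_transpose_of_trivial]⟩
  have hB0 : B = 0 := by
    by_contra hne
    obtain ⟨k, hk⟩ : ∃ k, B k ≠ 0 := by
      by_contra! h
      exact hne (funext h)
    have hbb : B k ⬝ᵥ B k ≠ 0 := by simpa using hk
    set b := B k with hb
    set c : ℝ := -2 * ((fun i => v i) ⬝ᵥ b) / (b ⬝ᵥ b) with hc
    have hcb : c * (b ⬝ᵥ b) = -2 * ((fun i => v i) ⬝ᵥ b) := by
      rw [hc]; field_simp
    set D : Matrix (Fin n) (Fin n) ℝ := vecMulVec (fun i => v i) b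
      + vecMulVec b (fun i => v i) + c • vecMulVec b b with hD
    have key : ∀ t : ℝ, -1 ≤ t * c - t ^ 2 →
        ((v + t • WithLp.toLp 2 b, u + t • D) :
          EuclideanSpace ℝ (Fin n) × Matrix (Fin n) (Fin n) ℝ) ∈
        {p : EuclideanSpace ℝ (Fin n) × Matrix (Fin n) (Fin n) ℝ |
          p.2.IsSymm ∧ p.2.trace = 0 ∧ eFun p.1 p.2 ≤ 1 / 2} := by
      intro t ht
      have hs : (u + t • D).IsSymm := by
        ext i j
        simp [hD, vecMulVec_apply, hu.apply i j]
        ring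
      refine ⟨hs, ?_, ?_⟩
      · simp only [trace_add, trace_smul, hD, htr, trace_vecMulVec, smul_eq_mul]
        rw [hcb, dotProduct_comm b]
        ring
      · rw [eFun_le_iff hn _ _ hs]
        convert psd_pert B k _ ht using 1
        rw [← hB, ← hb]
        ext i j
        simp [hD, vecMulVec_apply]
        ring
    set t : ℝ := 1 / (1 + |c|) with ht
    have hp : 0 < 1 + |c| := by positivity
    have htp : 0 < t := by positivity
    have ht1 : t * (1 + |c|) = 1 := by rw [ht]; field_simp
    have ht2 : t ≤ 1 := by nlinarith [abs_nonneg c]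
    have h1 := key t (by nlinarith [neg_abs_le c])
    have h2 := key (-t) (by nlinarith [le_abs_self c])
    have h3 := (hext _ h1 _ h2 ⟨1/2, 1/2, by norm_num, by norm_num, by norm_num, by
      ext1
      · simp only [Prod.fst_add, Prod.smul_fst]; module
      · simp only [Prod.snd_add, Prod.smul_snd]; module⟩).1
    have h4 := congrArg Prod.fst h3
    simp [htp.ne'] at h4
    exact hk h4
  have hu' : u = vecMulVec (fun i => v i) (fun i => v i)
      - (1 / (n : ℝ)) • (1 : Matrix (Fin n) (Fin n) ℝ) := by
    rw [hB0, mul_zero, sub_eq_zero] at hB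
    rw [hB]; abel
  refine ⟨v, ?_, by rw [← hu']⟩
  rw [hu', trace_sub, trace_vecMulVec, trace_smul, trace_one] at htr
  have h5 : ‖v‖ ^ 2 = 1 := by
    rw [EuclideanSpace.real_norm_sq_eq]
    simp [dotProduct, hn0.ne'] at htr
    simp only [sq]
    linarith
  nlinarith [norm_nonneg v]
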